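/- Let E ≥ 1, let μ be the Haar probability measure on O(E), let Ω be a real symmetric E×E matrix with Ω² = Ω and Tr(Ω) = L, let s ∈ ℝᴱ, and let r > 0. Then the vector-valued integral ∫ (1/r) (Oᵗ Ω O) s dμ(O) equals (L/(rE)) · s. -/

import Mathlib

open Matrix MeasureTheory

/-- The (Borel) measurable structure on real matrices, entrywise. -/
instance matrixMeasurableSpace (m n : Type*) : MeasurableSpace (Matrix m n ℝ) :=
  inferInstanceAs (MeasurableSpace (m → n → ℝ))

lemma measurable_matrix_entry {m n : Type*} (i : m) (j : n) :
    Measurable fun O : Matrix m n ℝ => O i j :=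
  (measurable_pi_apply j).comp (measurable_pi_apply (X := fun _ : m => n → ℝ) i)

section OrthogonalAverage

variable {n : Type*} [Fintype n]

lemma transpose_mul_mul_apply (Ω O : Matrix n n ℝ) (i j : n) :
    (Oᵀ * Ω * O) i j = ∑ x, ∑ y, Ω y x * (O y i * O x j) := by
  simp only [Matrix.mul_apply, Matrix.transpose_apply, Finset.sum_mul]
  exact Finset.sum_congr rfl fun x _ => Finset.sum_congr rfl fun y _ => by ring

lemma measurable_transpose_mul_mul_apply (Ω : Matrix n n ℝ) (i j : n) :
    Measurable fun O : Matrix n n ℝ => (Oᵀ * Ω * O) i j := by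
  simp only [transpose_mul_mul_apply]
  exact Finset.measurable_fun_sum _ fun x _ => Finset.measurable_fun_sum _ fun y _ =>
    ((measurable_matrix_entry y i).mul (measurable_matrix_entry x j)).const_mul _

variable [DecidableEq n]

lemma abs_entry_le_one_of_transpose_mul_self {O : Matrix n n ℝ} (hO : Oᵀ * O = 1) (i j : n) :
    |O i j| ≤ 1 := by
  have h : ∑ x, O x j * O x j = 1 := by
    simpa [Matrix.mul_apply] using congrFun (congrFun hO j) j
  have h' : O i j * O i j ≤ ∑ x, O x j * O x j :=
    Finset.single_le_sum (f := fun x => O x j * O x j) (fun x _ => mul_self_nonneg _)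
      (Finset.mem_univ i)
  rw [← sq_le_one_iff_abs_le_one]
  nlinarith

variable {μ : Measure (Matrix n n ℝ)} [IsProbabilityMeasure μ]

lemma integrable_transpose_mul_mul_apply (hμ : ∀ᵐ O ∂μ, Oᵀ * O = 1)
    (Ω : Matrix n n ℝ) (i j : n) :
    Integrable (fun O : Matrix n n ℝ => (Oᵀ * Ω * O) i j) μ := by
  simp only [transpose_mul_mul_apply]
  refine integrable_finsetSum _ fun x _ => integrable_finsetSum _ fun y _ =>
    Integrable.const_mul ?_ _
  refine Integrable.of_bound
    ((measurable_matrix_entry y i).mul (measurable_matrix_entry x j)).aestronglyMeasurable 1 ?_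
  filter_upwards [hμ] with O hO
  rw [Real.norm_eq_abs, abs_mul]
  exact mul_le_one₀ (abs_entry_le_one_of_transpose_mul_self hO y i) (abs_nonneg _)
    (abs_entry_le_one_of_transpose_mul_self hO x j)

lemma integral_transpose_mul_mul_apply_mul_right
    (hinv : ∀ Q : Matrix n n ℝ, Qᵀ * Q = 1 → Measure.map (fun O => O * Q) μ = μ)
    (Ω : Matrix n n ℝ) {Q : Matrix n n ℝ} (hQ : Qᵀ * Q = 1) (i j : n) :
    ∫ O, (Qᵀ * (Oᵀ * Ω * O) * Q) i j ∂μ = ∫ O, (Oᵀ * Ω * O) i j ∂μ := by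
  have hm : AEMeasurable (fun O : Matrix n n ℝ => O * Q) μ :=
    AEMeasurable.of_map_ne_zero (by rw [hinv Q hQ]; exact IsProbabilityMeasure.ne_zero μ)
  conv_rhs => rw [← hinv Q hQ]
  rw [integral_map hm (measurable_transpose_mul_mul_apply Ω i j).aestronglyMeasurable]
  simp only [Matrix.transpose_mul, Matrix.mul_assoc]

lemma integral_transpose_mul_mul_apply_of_ne
    (hinv : ∀ Q : Matrix n n ℝ, Qᵀ * Q = 1 → Measure.map (fun O => O * Q) μ = μ)
    (Ω : Matrix n n ℝ) {i j : n} (hij : i ≠ j) :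
    ∫ O, (Oᵀ * Ω * O) i j ∂μ = 0 := by
  let d : n → ℝ := fun k => if k = i then -1 else 1
  have hQ : (diagonal d)ᵀ * diagonal d = 1 := by
    rw [diagonal_transpose, diagonal_mul_diagonal, ← diagonal_one]
    congr 1
    ext k
    by_cases hk : k = i <;> simp [d, hk]
  have h := integral_transpose_mul_mul_apply_mul_right hinv Ω hQ i j
  simp only [diagonal_transpose, mul_diagonal, diagonal_mul] at h
  simp only [d, if_true, if_neg hij.symm, mul_one, neg_one_mul, integral_neg] at h
  linarith

lemma integral_transpose_mul_mul_apply_diag_eq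
    (hinv : ∀ Q : Matrix n n ℝ, Qᵀ * Q = 1 → Measure.map (fun O => O * Q) μ = μ)
    (Ω : Matrix n n ℝ) (i j : n) :
    ∫ O, (Oᵀ * Ω * O) i i ∂μ = ∫ O, (Oᵀ * Ω * O) j j ∂μ := by
  let σ : n ≃ n := Equiv.swap i j
  let Q : Matrix n n ℝ := (1 : Matrix n n ℝ).submatrix id σ
  have hQ : Qᵀ * Q = 1 := by
    ext k l
    simp [Q, Matrix.mul_apply, Matrix.one_apply]
  have h (A : Matrix n n ℝ) : (Qᵀ * A * Q) j j = A i i := by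
    simp [Q, σ, Matrix.mul_apply, Matrix.one_apply]
  rw [← integral_transpose_mul_mul_apply_mul_right hinv Ω hQ j j]
  simp only [h]

/-- The average of `Oᵀ Ω O` over the orthogonal group is the scalar matrix of trace `Tr Ω`. -/
lemma integral_transpose_mul_mul_apply (hμ : ∀ᵐ O ∂μ, Oᵀ * O = 1 ∧ O * Oᵀ = 1)
    (hinv : ∀ Q : Matrix n n ℝ, Qᵀ * Q = 1 → Measure.map (fun O => O * Q) μ = μ)
    (Ω : Matrix n n ℝ) (i j : n) :
    ∫ O, (Oᵀ * Ω * O) i j ∂μ = if i = j then Ω.trace / Fintype.card n else 0 := by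
  split_ifs with hij
  · subst hij
    have htr : ∑ k, ∫ O, (Oᵀ * Ω * O) k k ∂μ = Ω.trace := by
      rw [← integral_finsetSum _ fun k _ =>
        integrable_transpose_mul_mul_apply (hμ.mono fun _ h => h.1) Ω k k]
      have h : (fun O : Matrix n n ℝ => ∑ k, (Oᵀ * Ω * O) k k) =ᵐ[μ] fun _ => Ω.trace := by
        filter_upwards [hμ] with O hO
        change (Oᵀ * Ω * O).trace = Ω.trace
        rw [Matrix.trace_mul_comm, ← Matrix.mul_assoc, hO.2, Matrix.one_mul]
      rw [integral_congr_ae h]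
      simp
    rw [Finset.sum_congr rfl fun k _ =>
      integral_transpose_mul_mul_apply_diag_eq hinv Ω k i] at htr
    rw [Finset.sum_const, Finset.card_univ, nsmul_eq_mul] at htr
    have : (Fintype.card n : ℝ) ≠ 0 :=
      Nat.cast_ne_zero.2 (Fintype.card_pos_iff.2 ⟨i⟩).ne'
    rw [← htr]
    field_simp
  · exact integral_transpose_mul_mul_apply_of_ne hinv Ω hij

end OrthogonalAverage

/-- Averaged current of a resistive circuit over a cycle equivalence class:
for a projector `Ω` with `Tr Ω = L`, the Haar average (componentwise) of the
current `(1/r) (Oᵀ Ω O) s` over the orthogonal group equals `(L/(rE)) s`. -/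
theorem stmt_5 (E : ℕ) (hE : 1 ≤ E)
    (μ : Measure (Matrix (Fin E) (Fin E) ℝ)) [IsProbabilityMeasure μ]
    (hsupp : ∀ᵐ O ∂μ, Oᵀ * O = 1 ∧ O * Oᵀ = 1)
    (hinvL : ∀ Q : Matrix (Fin E) (Fin E) ℝ, Qᵀ * Q = 1 →
      Measure.map (fun O => Q * O) μ = μ)
    (hinvR : ∀ Q : Matrix (Fin E) (Fin E) ℝ, Qᵀ * Q = 1 →
      Measure.map (fun O => O * Q) μ = μ)
    (Ω : Matrix (Fin E) (Fin E) ℝ) (hΩsymm : Ω.IsSymm) (hΩproj : Ω * Ω = Ω)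
    (L : ℝ) (hL : Ω.trace = L)
    (s : Fin E → ℝ) (r : ℝ) (hr : 0 < r) :
    ∀ i : Fin E,
      ∫ O, (1 / r) * ((Oᵀ * Ω * O).mulVec s i) ∂μ = (L / (r * E)) * s i := by
  intro i
  simp only [Matrix.mulVec, dotProduct]
  rw [integral_const_mul, integral_finsetSum _ fun j _ =>
    (integrable_transpose_mul_mul_apply (hsupp.mono fun _ h => h.1) Ω i j).mul_const _]
  simp only [integral_mul_const, integral_transpose_mul_mul_apply hsupp hinvR, ite_mul, zero_mul,
    Finset.sum_ite_eq, Finset.mem_univ, if_true, Fintype.card_fin, hL]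
  have hE' : (E : ℝ) ≠ 0 := Nat.cast_ne_zero.2 (by omega)
  field_simp
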